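/- arXiv:1908.00229 — 2 statements merged into one kernel-verified Lean document; each statement's English description precedes it below -/
import Mathlib

section
/- Let d ≥ 2 and c > 0. There exist constants C = C(d,c) and L₀ = L₀(d,c) such that: for every integer L ≥ L₀, every ω ∈ ℝ with ‖kω‖ > c|k|^{−2} for all integers k with 0 < |k| ≤ L, every ε with ε > L^{−1/((d+1)·2^{d+1})}, and every x, a ∈ 𝕋^d, one has #{ n ∈ {1,…,L} : ‖T^n x − a‖ < ε } < C ε^d L, where T = T_ω is the skew shift on 𝕋^d. -/
open MeasureTheory

noncomputable section

/-- The circle `ℝ/ℤ`. -/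
abbrev 𝕋 : Type := AddCircle (1 : ℝ)

/-- The skew shift `T_ω : 𝕋^d → 𝕋^d`: `(Tx)_i = x_i + x_{i+1}` for `i < d - 1` and
`(Tx)_{d-1} = x_{d-1} + ω` (0-indexed coordinates `i : Fin d`). -/
def skewShift (d : ℕ) (ω : ℝ) (x : Fin d → 𝕋) : Fin d → 𝕋 := fun i =>
  if h : (i : ℕ) + 1 < d then x i + x ⟨(i : ℕ) + 1, h⟩ else x i + (ω : 𝕋)

/-! ### Polynomial phases -/

/-- `f : ℕ → 𝕋` is a polynomial sequence of degree at most `D` whose `D`-th iterated difference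
with unit steps is the constant `α`. -/
def IsPolyPhase : ℕ → (ℕ → 𝕋) → 𝕋 → Prop
  | 0, f, α => ∀ n, f n = α
  | D + 1, f, α => ∀ h : ℕ, IsPolyPhase D (fun n => f (n + h) - f n) (h • α)

namespace IsPolyPhase

theorem zero (D : ℕ) : IsPolyPhase D (fun _ => 0) 0 := by
  induction D with
  | zero => intro n; rfl
  | succ D ih => intro h; simpa using ih

theorem add {D : ℕ} {f g : ℕ → 𝕋} {α β : 𝕋} (hf : IsPolyPhase D f α) (hg : IsPolyPhase D g β) :
    IsPolyPhase D (fun n => f n + g n) (α + β) := by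
  induction D generalizing f g α β with
  | zero => intro n; exact congrArg₂ (· + ·) (hf n) (hg n)
  | succ D ih =>
    intro h
    have := ih (hf h) (hg h)
    simpa only [add_sub_add_comm, smul_add] using this

theorem sum {ι : Type*} (s : Finset ι) {D : ℕ} {f : ι → ℕ → 𝕋} {α : ι → 𝕋}
    (hf : ∀ i ∈ s, IsPolyPhase D (f i) (α i)) :
    IsPolyPhase D (fun n => ∑ i ∈ s, f i n) (∑ i ∈ s, α i) := by
  classical
  induction s using Finset.induction_on with
  | empty => simpa using zero D
  | insert a s ha ih =>
    simp only [Finset.sum_insert ha]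
    exact add (hf a (Finset.mem_insert_self a s))
      (ih fun i hi => hf i (Finset.mem_insert_of_mem hi))

theorem zsmul {D : ℕ} {f : ℕ → 𝕋} {α : 𝕋} (l : ℤ) (hf : IsPolyPhase D f α) :
    IsPolyPhase D (fun n => l • f n) (l • α) := by
  induction D generalizing f α with
  | zero => intro n; exact congrArg (l • ·) (hf n)
  | succ D ih =>
    intro h
    have := ih (hf h)
    rw [smul_comm]
    simpa only [smul_sub] using this

theorem shift {D : ℕ} {f : ℕ → 𝕋} {α : 𝕋} (s : ℕ) (hf : IsPolyPhase D f α) :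
    IsPolyPhase D (fun n => f (n + s)) α := by
  induction D generalizing f α with
  | zero => intro n; exact hf _
  | succ D ih =>
    intro h
    have := ih (hf h)
    simpa only [add_right_comm] using this

theorem succ_zero {D : ℕ} {f : ℕ → 𝕋} {α : 𝕋} (hf : IsPolyPhase D f α) :
    IsPolyPhase (D + 1) f 0 := by
  induction D generalizing f α with
  | zero => intro h n; simp [hf _]
  | succ D ih =>
    intro h
    rw [smul_zero]
    exact ih (hf h)

theorem of_lt {D E : ℕ} (hDE : D < E) {f : ℕ → 𝕋} {α : 𝕋} (hf : IsPolyPhase D f α) :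
    IsPolyPhase E f 0 := by
  induction E, hDE using Nat.le_induction with
  | base => exact hf.succ_zero
  | succ E _ ih => exact ih.succ_zero

theorem of_diff {D : ℕ} {f : ℕ → 𝕋} {α : 𝕋} (hf : IsPolyPhase D (fun n => f (n + 1) - f n) α) :
    IsPolyPhase (D + 1) f α := by
  intro h
  induction h with
  | zero => simpa using zero D
  | succ h ih =>
    have := add ih (hf.shift h)
    rw [succ_nsmul]
    convert this using 2 with n
    rw [show n + (h + 1) = n + h + 1 by ring]
    abel

theorem sub_const {D : ℕ} {f : ℕ → 𝕋} {α : 𝕋} (a : 𝕋) (hf : IsPolyPhase (D + 1) f α) :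
    IsPolyPhase (D + 1) (fun n => f n - a) α := by
  intro h
  simpa using hf h

end IsPolyPhase

theorem isPolyPhase_skewShift {d : ℕ} (ω : ℝ) (x : Fin d → 𝕋) (i : Fin d) :
    IsPolyPhase (d - i) (fun n => (skewShift d ω)^[n] x i) (ω : 𝕋) := by
  obtain ⟨k, hk⟩ : ∃ k, d - (i : ℕ) = k + 1 := ⟨d - i - 1, by omega⟩
  induction k generalizing i with
  | zero =>
    rw [hk]
    refine IsPolyPhase.of_diff fun n => ?_
    have : ¬ (i : ℕ) + 1 < d := by omega
    simp only [Function.iterate_succ_apply']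
    rw [skewShift, dif_neg this]
    abel
  | succ k ih =>
    rw [hk]
    refine IsPolyPhase.of_diff ?_
    have hi : (i : ℕ) + 1 < d := by omega
    have h := ih ⟨i + 1, hi⟩ (by simp only; omega)
    rw [show d - ((⟨i + 1, hi⟩ : Fin d) : ℕ) = k + 1 by simp only; omega] at h
    convert h using 2 with n
    simp only [Function.iterate_succ_apply']
    rw [skewShift, dif_pos hi]
    abel

theorem exists_isPolyPhase_sum_smul_skewShift {d : ℕ} (ω : ℝ) (x a : Fin d → 𝕋) (l : Fin d → ℤ)
    (hl : l ≠ 0) :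
    ∃ i, l i ≠ 0 ∧
      IsPolyPhase (d - i) (fun n => ∑ k, l k • ((skewShift d ω)^[n] x k - a k)) (l i • (ω : 𝕋)) := by
  obtain ⟨i, hi, hmin⟩ : ∃ i, l i ≠ 0 ∧ ∀ k < i, l k = 0 := by
    obtain ⟨j, hj⟩ := Function.ne_iff.mp hl
    obtain ⟨i, hi, hmin⟩ := WellFounded.has_min (wellFounded_lt (α := Fin d)) {k | l k ≠ 0} ⟨j, hj⟩
    exact ⟨i, hi, fun k hk => by_contra fun h => hmin k h hk⟩
  refine ⟨i, hi, ?_⟩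
  have key : ∀ k ∈ Finset.univ, IsPolyPhase (d - i)
      (fun n => l k • ((skewShift d ω)^[n] x k - a k)) (if k = i then l i • (ω : 𝕋) else 0) := by
    intro k _
    have hk : IsPolyPhase (d - k) (fun n => (skewShift d ω)^[n] x k - a k) (ω : 𝕋) := by
      have := isPolyPhase_skewShift ω x k
      obtain ⟨e, he⟩ : ∃ e, d - (k : ℕ) = e + 1 := ⟨d - k - 1, by omega⟩
      rw [he] at this ⊢
      exact this.sub_const (a k)
    rcases lt_trichotomy k i with h | h | h
    · rw [if_neg h.ne, hmin k h]
      simpa using IsPolyPhase.zero (d - i)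
    · subst h
      rw [if_pos rfl]
      exact hk.zsmul _
    · rw [if_neg h.ne']
      have : (i : ℕ) < k := h
      exact (hk.zsmul (l k)).of_lt (by omega)
  simpa using IsPolyPhase.sum Finset.univ key

/-! ### Exponential sums -/

/-- The standard character `t ↦ exp (2 π i t)` of the circle. -/
def circleChar (t : 𝕋) : ℂ := AddCircle.toCircle t

theorem norm_circleChar (t : 𝕋) : ‖circleChar t‖ = 1 := Circle.norm_coe _

theorem circleChar_add (s t : 𝕋) : circleChar (s + t) = circleChar s * circleChar t := by
  simp [circleChar, AddCircle.toCircle_add]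

theorem circleChar_neg (t : 𝕋) : circleChar (-t) = starRingEnd ℂ (circleChar t) := by
  rw [circleChar, circleChar, AddCircle.toCircle_neg, Circle.coe_inv_eq_conj]

theorem circleChar_sub (s t : 𝕋) :
    circleChar (s - t) = circleChar s * starRingEnd ℂ (circleChar t) := by
  rw [sub_eq_add_neg, circleChar_add, circleChar_neg]

theorem circleChar_coe (t : ℝ) :
    circleChar (t : 𝕋) = Complex.exp (Complex.I * ((2 * Real.pi * t : ℝ) : ℂ)) := by
  rw [circleChar, AddCircle.toCircle_apply_mk, Circle.coe_exp, mul_comm, div_one]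

theorem exists_coe_eq_abs_eq_norm (y : 𝕋) : ∃ t : ℝ, (t : 𝕋) = y ∧ |t| = ‖y‖ ∧ |t| ≤ 1 / 2 := by
  obtain ⟨x, rfl⟩ := QuotientAddGroup.mk_surjective y
  have h : ‖((x : ℝ) : 𝕋)‖ = |x - round x| := UnitAddCircle.norm_eq
  refine ⟨x - round x, ?_, h.symm, abs_sub_round x⟩
  have h1 : ((round x : ℝ) : 𝕋) = 0 := by
    rw [AddCircle.coe_eq_zero_iff]
    exact ⟨round x, by simp⟩
  rw [AddCircle.coe_sub, h1, sub_zero]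

theorem norm_coe_le_abs (t : ℝ) : ‖(t : 𝕋)‖ ≤ |t| := by
  rw [UnitAddCircle.norm_eq]
  simpa using round_le t 0

theorem half_le_re_circleChar {t : 𝕋} (ht : ‖t‖ ≤ 1 / 6) : 1 / 2 ≤ (circleChar t).re := by
  obtain ⟨s, rfl, hs, -⟩ := exists_coe_eq_abs_eq_norm t
  rw [← hs] at ht
  rw [circleChar_coe, mul_comm, Complex.exp_ofReal_mul_I_re, ← Real.cos_pi_div_three,
    ← Real.cos_abs (2 * Real.pi * s)]
  have hpi := Real.pi_pos
  apply Real.cos_le_cos_of_nonneg_of_le_pi (abs_nonneg _) (by linarith)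
  rw [abs_mul, abs_of_pos (by positivity : (0 : ℝ) < 2 * Real.pi)]
  nlinarith

theorem two_mul_norm_le_norm_circleChar_sub_one (t : 𝕋) : 2 * ‖t‖ ≤ ‖circleChar t - 1‖ := by
  obtain ⟨s, rfl, hs, hs'⟩ := exists_coe_eq_abs_eq_norm t
  have hpi := Real.pi_pos
  rw [circleChar_coe, Complex.norm_exp_I_mul_ofReal_sub_one, ← hs,
    show 2 * Real.pi * s / 2 = Real.pi * s by ring, norm_mul, Real.norm_eq_abs, Real.norm_eq_abs,
    abs_two]
  have h1 : |Real.pi * s| = Real.pi * |s| := by rw [abs_mul, abs_of_pos hpi]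
  have h := Real.mul_abs_le_abs_sin (x := Real.pi * s) (by rw [h1]; nlinarith)
  rw [h1, show 2 / Real.pi * (Real.pi * |s|) = 2 * |s| by field_simp] at h
  linarith [abs_nonneg s]

theorem norm_sum_circleChar_le {ι : Type*} (s : Finset ι) (f : ι → 𝕋) :
    ‖∑ i ∈ s, circleChar (f i)‖ ≤ s.card := by
  refine (norm_sum_le _ _).trans ?_
  simp [norm_circleChar]

theorem IsPolyPhase.norm_sum_mul_le {f : ℕ → 𝕋} {α : 𝕋} (hf : IsPolyPhase 1 f α) (L : ℕ) :
    ‖∑ n ∈ Finset.range L, circleChar (f n)‖ * ‖α‖ ≤ 1 := by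
  have hfn : ∀ n, circleChar (f n) = circleChar (f 0) * circleChar α ^ n := by
    intro n
    have h : f (0 + n) - f 0 = n • α := hf n 0
    rw [zero_add, sub_eq_iff_eq_add'] at h
    rw [h, circleChar_add, circleChar, circleChar, circleChar, AddCircle.toCircle_nsmul,
      Circle.coe_pow]
  rw [Finset.sum_congr rfl fun n _ => hfn n, ← Finset.mul_sum, norm_mul, norm_circleChar, one_mul]
  have h1 := two_mul_norm_le_norm_circleChar_sub_one α
  have h2 : ‖∑ n ∈ Finset.range L, circleChar α ^ n‖ * ‖circleChar α - 1‖ ≤ 2 := by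
    rw [← norm_mul, geom_sum_mul]
    refine (norm_sub_le _ _).trans ?_
    rw [norm_pow, norm_circleChar]
    norm_num
  nlinarith [norm_nonneg (∑ n ∈ Finset.range L, circleChar α ^ n)]

theorem norm_sum_range_sub_sum_shift_le {z : ℕ → ℂ} (hz : ∀ n, ‖z n‖ ≤ 1) (L h : ℕ) :
    ‖∑ n ∈ Finset.range L, z n - ∑ n ∈ Finset.range L, z (n + h)‖ ≤ 2 * h := by
  induction h with
  | zero => simp
  | succ h ih =>
    have h1 : ∑ n ∈ Finset.range L, z (n + h) - ∑ n ∈ Finset.range L, z (n + (h + 1))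
        = z h - z (L + h) := by
      rw [← Finset.sum_sub_distrib]
      have := Finset.sum_range_sub' (fun n => z (n + h)) L
      simp only [zero_add] at this
      rw [← this]
      exact Finset.sum_congr rfl fun n _ => by rw [show n + (h + 1) = n + 1 + h by ring]
    have h2 : ‖z h - z (L + h)‖ ≤ 2 := (norm_sub_le _ _).trans (by linarith [hz h, hz (L + h)])
    calc _ = ‖(∑ n ∈ Finset.range L, z n - ∑ n ∈ Finset.range L, z (n + h)) +
          (∑ n ∈ Finset.range L, z (n + h) - ∑ n ∈ Finset.range L, z (n + (h + 1)))‖ := by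
            rw [sub_add_sub_cancel]
      _ ≤ 2 * h + 2 := (norm_add_le _ _).trans (by rw [h1]; linarith)
      _ = _ := by push_cast; ring

/-- **Van der Corput's inequality** for exponential sums over an initial interval. -/
theorem sq_norm_sum_circleChar_le (f : ℕ → 𝕋) (L H : ℕ) (hH : 0 < H) (G : ℕ → ℝ)
    (hG : ∀ k ∈ Finset.Ico 1 H, ∀ s,
      ‖∑ n ∈ Finset.range L, circleChar (f (n + s + k) - f (n + s))‖ ≤ G k) :
    ‖∑ n ∈ Finset.range L, circleChar (f n)‖ ^ 2 ≤
      8 * (H : ℝ) ^ 2 + 2 * (L : ℝ) ^ 2 / H + 4 * L / H * ∑ k ∈ Finset.Ico 1 H, G k := by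
  have hH' : (0 : ℝ) < H := by exact_mod_cast hH
  set S := ∑ n ∈ Finset.range L, circleChar (f n) with hS
  set W : ℕ → ℂ := fun n => ∑ h ∈ Finset.range H, circleChar (f (n + h)) with hW
  set Γ := ∑ k ∈ Finset.Ico 1 H, G k with hΓ
  have hGnn : ∀ k ∈ Finset.Ico 1 H, 0 ≤ G k := fun k hk => (norm_nonneg _).trans (hG k hk 0)
  have step1 : H * ‖S‖ ≤ 2 * (H : ℝ) ^ 2 + ∑ n ∈ Finset.range L, ‖W n‖ := by
    have e1 : (H : ℂ) * S = ∑ h ∈ Finset.range H, (S - ∑ n ∈ Finset.range L, circleChar (f (n + h)))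
        + ∑ n ∈ Finset.range L, W n := by
      rw [Finset.sum_sub_distrib, hW, Finset.sum_comm (s := Finset.range L)]
      simp
    have e2 : (H : ℝ) * ‖S‖ = ‖(H : ℂ) * S‖ := by simp
    rw [e2, e1]
    refine (norm_add_le _ _).trans (add_le_add ?_ (norm_sum_le _ _))
    refine (norm_sum_le _ _).trans ?_
    calc _ ≤ ∑ h ∈ Finset.range H, 2 * (H : ℝ) := by
          refine Finset.sum_le_sum fun h hh => ?_
          have hh' : (h : ℝ) ≤ H := by exact_mod_cast (Finset.mem_range.mp hh).le
          have := norm_sum_range_sub_sum_shift_le (z := fun n => circleChar (f n))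
            (fun n => (norm_circleChar _).le) L h
          exact this.trans (by linarith)
      _ = 2 * (H : ℝ) ^ 2 := by simp; ring
  have step2 : (∑ n ∈ Finset.range L, ‖W n‖) ^ 2 ≤ L * ∑ n ∈ Finset.range L, ‖W n‖ ^ 2 := by
    simpa using sq_sum_le_card_mul_sum_sq (s := Finset.range L) (f := fun n => ‖W n‖)
  have pair : ∀ h ∈ Finset.range H, ∀ h' ∈ Finset.range H, h' < h →
      ‖∑ n ∈ Finset.range L, circleChar (f (n + h) - f (n + h'))‖ ≤ G (h - h') := by
    intro h hh h' hh' hlt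
    rw [Finset.mem_range] at hh
    have := hG (h - h') (Finset.mem_Ico.mpr ⟨by omega, by omega⟩) h'
    simpa only [add_assoc, Nat.add_sub_cancel' hlt.le] using this
  have pair' : ∀ h ∈ Finset.range H, ∀ h' ∈ Finset.range H, h < h' →
      ‖∑ n ∈ Finset.range L, circleChar (f (n + h) - f (n + h'))‖ ≤ G (h' - h) := by
    intro h hh h' hh' hlt
    have := pair h' hh' h hh hlt
    rw [← RCLike.norm_conj, map_sum] at this
    simpa only [← circleChar_neg, neg_sub] using this
  have step3 : ∑ n ∈ Finset.range L, ‖W n‖ ^ 2 ≤ H * L + 2 * H * Γ := by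
    have e1 : ((∑ n ∈ Finset.range L, ‖W n‖ ^ 2 : ℝ) : ℂ) = ∑ h ∈ Finset.range H,
        ∑ h' ∈ Finset.range H, ∑ n ∈ Finset.range L, circleChar (f (n + h) - f (n + h')) := by
      push_cast
      rw [Finset.sum_congr rfl fun h _ => Finset.sum_comm, Finset.sum_comm]
      refine Finset.sum_congr rfl fun n _ => ?_
      rw [← Complex.mul_conj', hW, map_sum, Finset.sum_mul_sum]
      simp only [circleChar_sub]
    have e2 : ∑ n ∈ Finset.range L, ‖W n‖ ^ 2 =
        ‖((∑ n ∈ Finset.range L, ‖W n‖ ^ 2 : ℝ) : ℂ)‖ := by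
      rw [Complex.norm_real, Real.norm_of_nonneg (by positivity)]
    rw [e2, e1]
    refine (norm_sum_le _ _).trans ?_
    calc _ ≤ ∑ h ∈ Finset.range H, ((L : ℝ) + 2 * Γ) := ?_
      _ = _ := by simp; ring
    refine Finset.sum_le_sum fun h hh => (norm_sum_le _ _).trans ?_
    have hhH := Finset.mem_range.mp hh
    have hsplit : Finset.range H = Finset.range h ∪ ({h} ∪ Finset.Ico (h + 1) H) := by
      ext k; simp only [Finset.mem_range, Finset.mem_union, Finset.mem_singleton, Finset.mem_Ico]
      omega
    rw [hsplit, Finset.sum_union, Finset.sum_union, Finset.sum_singleton]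
    rotate_left
    · rw [Finset.disjoint_left]; intro k; simp only [Finset.mem_singleton, Finset.mem_Ico]; omega
    · rw [Finset.disjoint_left]; intro k
      simp only [Finset.mem_range, Finset.mem_union, Finset.mem_singleton, Finset.mem_Ico]
      omega
    have b1 : ∑ h' ∈ Finset.range h,
        ‖∑ n ∈ Finset.range L, circleChar (f (n + h) - f (n + h'))‖ ≤ Γ := by
      calc _ ≤ ∑ h' ∈ Finset.range h, G (h - h') := Finset.sum_le_sum fun h' hh' =>
              pair h hh h' (by simp at hh' ⊢; omega) (by simpa using hh')
        _ = ∑ k ∈ (Finset.range h).image (fun h' => h - h'), G k := by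
              rw [Finset.sum_image]
              intro a ha b hb hab
              simp at ha hb hab
              omega
        _ ≤ Γ := by
              refine Finset.sum_le_sum_of_subset_of_nonneg ?_ fun k hk _ => hGnn k hk
              intro k
              simp only [Finset.mem_image, Finset.mem_range, Finset.mem_Ico]
              rintro ⟨a, ha, rfl⟩
              omega
    have b2 : ∑ h' ∈ Finset.Ico (h + 1) H,
        ‖∑ n ∈ Finset.range L, circleChar (f (n + h) - f (n + h'))‖ ≤ Γ := by
      calc _ ≤ ∑ h' ∈ Finset.Ico (h + 1) H, G (h' - h) := Finset.sum_le_sum fun h' hh' =>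
              pair' h hh h' (by simp at hh' ⊢; omega) (by simp at hh'; omega)
        _ = ∑ k ∈ (Finset.Ico (h + 1) H).image (fun h' => h' - h), G k := by
              rw [Finset.sum_image]
              intro a ha b hb hab
              simp at ha hb hab
              omega
        _ ≤ Γ := by
              refine Finset.sum_le_sum_of_subset_of_nonneg ?_ fun k hk _ => hGnn k hk
              intro k
              simp only [Finset.mem_image, Finset.mem_Ico]
              rintro ⟨a, ha, rfl⟩
              omega
    have b3 : ‖∑ n ∈ Finset.range L, circleChar (f (n + h) - f (n + h))‖ ≤ L := by
      simpa using norm_sum_circleChar_le (Finset.range L) (fun n => f (n + h) - f (n + h))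
    linarith
  have step4 : (H * ‖S‖) ^ 2 ≤ 8 * (H : ℝ) ^ 4 + 2 * (L * (H * L + 2 * H * Γ)) := by
    have hW0 : 0 ≤ ∑ n ∈ Finset.range L, ‖W n‖ := by positivity
    have : (H * ‖S‖) ^ 2 ≤ (2 * (H : ℝ) ^ 2 + ∑ n ∈ Finset.range L, ‖W n‖) ^ 2 :=
      pow_le_pow_left₀ (by positivity) step1 2
    have h3 : (L : ℝ) * ∑ n ∈ Finset.range L, ‖W n‖ ^ 2 ≤ L * (H * L + 2 * H * Γ) := by gcongr
    nlinarith [sq_nonneg (2 * (H : ℝ) ^ 2 - ∑ n ∈ Finset.range L, ‖W n‖)]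
  have h5 : 8 * (H : ℝ) ^ 2 + 2 * (L : ℝ) ^ 2 / H + 4 * L / H * Γ =
      (8 * (H : ℝ) ^ 4 + 2 * (L * (H * L + 2 * H * Γ))) / H ^ 2 := by
    field_simp
    ring
  rw [h5, le_div_iff₀ (by positivity)]
  linarith [mul_pow (H : ℝ) ‖S‖ 2]

theorem sum_inv_norm_nsmul_le (β : 𝕋) (H : ℕ) {δ : ℝ} (hδ : 0 < δ)
    (h : ∀ k ∈ Finset.Ico 1 H, δ < ‖k • β‖) :
    ∑ k ∈ Finset.Ico 1 H, 1 / ‖k • β‖ ≤ 4 / δ * (1 + Real.log (1 / δ + 2)) := by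
  choose t ht habs hhalf using fun k : ℕ => exists_coe_eq_abs_eq_norm (k • β)
  set j : ℕ → ℤ := fun k => ⌊t k / δ⌋ with hj
  have jle : ∀ k, j k * δ ≤ t k := fun k => (le_div_iff₀ hδ).mp (Int.floor_le _)
  have jlt : ∀ k, t k < (j k + 1) * δ := fun k => (div_lt_iff₀ hδ).mp (Int.lt_floor_add_one _)
  have hδt : ∀ k ∈ Finset.Ico 1 H, δ < |t k| := fun k hk => by rw [habs]; exact h k hk
  have hj0 : ∀ k ∈ Finset.Ico 1 H, j k ≠ 0 := by
    intro k hk h0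
    have h1 := jle k
    have h2 := jlt k
    rw [h0] at h1 h2
    simp only [Int.cast_zero, zero_mul, zero_add, one_mul] at h1 h2
    have := hδt k hk
    rw [abs_of_nonneg h1] at this
    linarith
  have hlt : ∀ k ∈ Finset.Ico 1 H, ∀ k' ∈ Finset.Ico 1 H, k < k' → j k ≠ j k' := by
    intro k hk k' hk' hkk heq
    rw [Finset.mem_Ico] at hk hk'
    have h1 := h (k' - k) (Finset.mem_Ico.mpr ⟨by omega, by omega⟩)
    have h2 : (k' - k) • β = ((t k' - t k : ℝ) : 𝕋) := by
      rw [AddCircle.coe_sub, ht, ht, eq_sub_iff_add_eq, ← add_nsmul, Nat.sub_add_cancel hkk.le]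
    rw [h2] at h1
    have h3 := norm_coe_le_abs (t k' - t k)
    have h4 : |t k' - t k| < δ := by
      have a1 := jle k
      have a2 := jlt k
      have a3 := jle k'
      have a4 := jlt k'
      rw [heq] at a1 a2
      rw [abs_lt]
      constructor <;> linarith
    linarith
  have hlow : ∀ k ∈ Finset.Ico 1 H, δ * |(j k : ℝ)| / 2 ≤ |t k| := by
    intro k hk
    have h1 := jle k
    have h2 := jlt k
    have h3 := hδt k hk
    rcases lt_or_gt_of_ne (hj0 k hk) with h0 | h0
    · have h0' : (j k : ℝ) < 0 := by exact_mod_cast h0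
      rw [abs_of_neg h0']
      have h4 := neg_abs_le (t k)
      nlinarith
    · have h0' : (0 : ℝ) < j k := by exact_mod_cast h0
      rw [abs_of_pos h0']
      have h4 := le_abs_self (t k)
      nlinarith
  set p : ℕ → ℕ := fun k => if 0 < j k then 2 * (j k).natAbs else 2 * (j k).natAbs - 1 with hp
  have hp1 : ∀ k ∈ Finset.Ico 1 H, 1 ≤ p k := by
    intro k hk
    have := hj0 k hk
    simp only [hp]
    split_ifs <;> omega
  have hp2 : ∀ k, p k ≤ 2 * (j k).natAbs := by
    intro k
    simp only [hp]
    split_ifs <;> omega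
  have hpinj : Set.InjOn p (Finset.Ico 1 H : Finset ℕ) := by
    intro k hk k' hk' hkk
    have e1 := hj0 k hk
    have e2 := hj0 k' hk'
    have e3 : j k = j k' := by
      simp only [hp] at hkk
      split_ifs at hkk <;> omega
    rcases lt_trichotomy k k' with hl | hl | hl
    · exact absurd e3 (hlt k hk k' hk' hl)
    · exact hl
    · exact absurd e3.symm (hlt k' hk' k hk hl)
  have hcast : ∀ k, ((j k).natAbs : ℝ) = |(j k : ℝ)| := fun k => by
    rw [Nat.cast_natAbs, Int.cast_abs]
  set J : ℕ := ⌊1 / δ + 2⌋₊ with hJ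
  have hpJ : ∀ k ∈ Finset.Ico 1 H, p k ≤ J := by
    intro k hk
    apply Nat.le_floor
    have h1 : (p k : ℝ) ≤ 2 * |(j k : ℝ)| := by
      rw [← hcast]
      exact_mod_cast hp2 k
    have h2 : |(j k : ℝ)| ≤ 1 / δ / 2 + 1 := by
      have a1 := jle k
      have a2 := jlt k
      obtain ⟨a3, a4⟩ := abs_le.mp (hhalf k)
      have e : (1 / δ / 2 + 1) * δ = 1 / 2 + δ := by field_simp
      rw [abs_le]
      constructor
      · refine le_of_mul_le_mul_right ?_ hδ
        linarith
      · refine le_of_mul_le_mul_right ?_ hδ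
        linarith
    linarith
  calc ∑ k ∈ Finset.Ico 1 H, 1 / ‖k • β‖
      ≤ ∑ k ∈ Finset.Ico 1 H, 4 / δ * ((p k : ℝ))⁻¹ := by
        refine Finset.sum_le_sum fun k hk => ?_
        have hpk : (0 : ℝ) < p k := by exact_mod_cast hp1 k hk
        have h1 : (p k : ℝ) ≤ 2 * |(j k : ℝ)| := by
          rw [← hcast]
          exact_mod_cast hp2 k
        have h2 := hlow k hk
        rw [← habs, ← div_eq_mul_inv, div_div, div_le_div_iff₀ (hδ.trans (hδt k hk)) (by positivity)]
        nlinarith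
    _ = 4 / δ * ∑ q ∈ (Finset.Ico 1 H).image p, ((q : ℝ))⁻¹ := by
        rw [← Finset.mul_sum, Finset.sum_image hpinj]
    _ ≤ 4 / δ * ∑ q ∈ Finset.Icc 1 J, ((q : ℝ))⁻¹ := by
        gcongr
        intro q
        simp only [Finset.mem_image, Finset.mem_Icc]
        rintro ⟨k, hk, rfl⟩
        exact ⟨hp1 k hk, hpJ k hk⟩
    _ ≤ 4 / δ * (1 + Real.log (1 / δ + 2)) := by
        have h1 := harmonic_le_one_add_log J
        rw [harmonic_eq_sum_Icc] at h1
        push_cast at h1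
        have h2 : Real.log J ≤ Real.log (1 / δ + 2) := by
          have hJ1 : 1 ≤ J := Nat.le_floor (by push_cast; linarith [one_div_pos.mpr hδ])
          apply Real.log_le_log (by exact_mod_cast hJ1)
          exact Nat.floor_le (by positivity)
        gcongr
        linarith

/-- `‖k ω‖ > c / k ^ 2` for all nonzero integers `k` with `|k| ≤ L`. -/
def IsDiophantineUpTo (c : ℝ) (L : ℕ) (ω : ℝ) : Prop :=
  ∀ k : ℤ, k ≠ 0 → |k| ≤ (L : ℤ) → c / (k : ℝ) ^ 2 < ‖((k * ω : ℝ) : 𝕋)‖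

theorem IsDiophantineUpTo.lt_norm_zsmul {c : ℝ} {L : ℕ} {ω : ℝ} (hω : IsDiophantineUpTo c L ω)
    {k : ℤ} (hk : k ≠ 0) (hkL : |(k : ℝ)| ≤ L) : c / (k : ℝ) ^ 2 < ‖k • (ω : 𝕋)‖ := by
  have := hω k hk (by exact_mod_cast hkL)
  rwa [← AddCircle.coe_zsmul, zsmul_eq_mul]

/-- Exponential sums with polynomial phase of degree `D` and leading difference `m • ω`, where
`ω` is Diophantine up to `L` and `0 < |m| ≤ L ^ μ`, are `O(L ^ (1 - s))`. -/
def HasWeylBound (c : ℝ) (D : ℕ) (μ s : ℝ) : Prop :=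
  ∃ (K : ℝ) (L₀ : ℕ), 0 < K ∧ ∀ L : ℕ, L₀ ≤ L → ∀ ω : ℝ, IsDiophantineUpTo c L ω →
    ∀ m : ℤ, m ≠ 0 → |(m : ℝ)| ≤ (L : ℝ) ^ μ → ∀ f : ℕ → 𝕋, IsPolyPhase D f (m • (ω : 𝕋)) →
      ‖∑ n ∈ Finset.range L, circleChar (f n)‖ ≤ K * (L : ℝ) ^ (1 - s)

theorem hasWeylBound_one {c : ℝ} (hc : 0 < c) {μ s : ℝ} (hs : 0 ≤ s)
    (h : s + 2 * μ ≤ 1) : HasWeylBound c 1 μ s := by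
  refine ⟨1 / c, 1, by positivity, fun L hL ω hω m hm hmL f hf => ?_⟩
  have hL1 : (1 : ℝ) ≤ L := by exact_mod_cast hL
  have hm' : 0 < |(m : ℝ)| := abs_pos.mpr (by exact_mod_cast hm)
  have hm2 : (0 : ℝ) < (m : ℝ) ^ 2 := by rw [← sq_abs]; positivity
  have h1 := hω.lt_norm_zsmul hm
    (hmL.trans ((Real.rpow_le_rpow_of_exponent_le hL1 (by linarith)).trans_eq (Real.rpow_one _)))
  have h2 := hf.norm_sum_mul_le L
  have h3 : (m : ℝ) ^ 2 ≤ (L : ℝ) ^ (1 - s) := by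
    calc (m : ℝ) ^ 2 = |(m : ℝ)| ^ 2 := (sq_abs _).symm
      _ ≤ ((L : ℝ) ^ μ) ^ 2 := by gcongr
      _ = (L : ℝ) ^ (μ * 2) := by rw [Real.rpow_mul (by positivity)]; norm_cast
      _ ≤ _ := Real.rpow_le_rpow_of_exponent_le hL1 (by linarith)
  set S := ‖∑ n ∈ Finset.range L, circleChar (f n)‖ with hS
  have hS0 : 0 ≤ S := norm_nonneg _
  have h4 : S * (c / (m : ℝ) ^ 2) ≤ 1 := (mul_le_mul_of_nonneg_left h1.le hS0).trans h2
  rw [mul_div_assoc', div_le_one hm2] at h4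
  rw [one_div, ← div_eq_inv_mul, le_div_iff₀ hc]
  linarith

theorem half_rpow_le_floor {L x : ℝ} (hL : 1 ≤ L) (hx : 0 ≤ x) : L ^ x / 2 ≤ ⌊L ^ x⌋₊ := by
  have h1 : 1 ≤ L ^ x := Real.one_le_rpow hL hx
  have h2 := Nat.lt_floor_add_one (L ^ x)
  have h3 : (1 : ℝ) ≤ ⌊L ^ x⌋₊ := by exact_mod_cast Nat.le_floor (by simpa using h1)
  linarith

theorem norm_sum_circleChar_le_of_differences (f : ℕ → 𝕋) {L : ℕ} (hL : 1 ≤ L) {s B : ℝ}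
    (hs : 0 ≤ s) (hs' : 4 * s ≤ 1) (hB : 0 ≤ B) (G : ℕ → ℝ)
    (hG : ∀ k ∈ Finset.Ico 1 ⌊(L : ℝ) ^ (2 * s)⌋₊, ∀ t,
      ‖∑ n ∈ Finset.range L, circleChar (f (n + t + k) - f (n + t))‖ ≤ G k)
    (hGB : 4 * L / ⌊(L : ℝ) ^ (2 * s)⌋₊ * ∑ k ∈ Finset.Ico 1 ⌊(L : ℝ) ^ (2 * s)⌋₊, G k ≤
      B * (L : ℝ) ^ (2 - 2 * s)) :
    ‖∑ n ∈ Finset.range L, circleChar (f n)‖ ≤ (12 + B) * (L : ℝ) ^ (1 - s) := by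
  have hL1 : (1 : ℝ) ≤ L := by exact_mod_cast hL
  have hL0 : (0 : ℝ) < L := by linarith
  set H := ⌊(L : ℝ) ^ (2 * s)⌋₊ with hH
  have hHlow : (L : ℝ) ^ (2 * s) / 2 ≤ H := half_rpow_le_floor hL1 (by linarith)
  have hHup : (H : ℝ) ≤ (L : ℝ) ^ (2 * s) := Nat.floor_le (by positivity)
  have hHpos : (0 : ℝ) < H := lt_of_lt_of_le (by positivity) hHlow
  have h := sq_norm_sum_circleChar_le f L H (by exact_mod_cast hHpos) G hG
  have h1 : (H : ℝ) ^ 2 ≤ (L : ℝ) ^ (2 - 2 * s) := by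
    calc (H : ℝ) ^ 2 ≤ ((L : ℝ) ^ (2 * s)) ^ 2 := by gcongr
      _ = (L : ℝ) ^ (2 * s * 2) := by rw [Real.rpow_mul (by positivity) (2 * s) 2]; norm_cast
      _ ≤ _ := Real.rpow_le_rpow_of_exponent_le hL1 (by linarith)
  have h2 : (L : ℝ) ^ 2 / H ≤ 2 * (L : ℝ) ^ (2 - 2 * s) := by
    rw [div_le_iff₀ hHpos]
    calc (L : ℝ) ^ 2 = (L : ℝ) ^ (2 - 2 * s) * (L : ℝ) ^ (2 * s) := by
          rw [← Real.rpow_add hL0, sub_add_cancel]; norm_cast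
      _ ≤ (L : ℝ) ^ (2 - 2 * s) * (2 * H) := by gcongr; linarith
      _ = _ := by ring
  have h3 : ((L : ℝ) ^ (1 - s)) ^ 2 = (L : ℝ) ^ (2 - 2 * s) := by
    rw [show 2 - 2 * s = (1 - s) * 2 by ring, Real.rpow_mul (by positivity) (1 - s) 2]; norm_cast
  refine le_of_sq_le_sq ?_ (by positivity)
  rw [mul_pow, h3]
  have h4 : (0 : ℝ) < (L : ℝ) ^ (2 - 2 * s) := by positivity
  have h5 : 2 * (L : ℝ) ^ 2 / H = 2 * ((L : ℝ) ^ 2 / H) := by ring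
  rw [h5] at h
  calc _ ≤ (12 + B) * (L : ℝ) ^ (2 - 2 * s) := by linarith
    _ ≤ _ := by
      gcongr
      nlinarith

theorem IsPolyPhase.diff_shift {D : ℕ} {f : ℕ → 𝕋} {α : 𝕋} (hf : IsPolyPhase (D + 1) f α)
    (k t : ℕ) : IsPolyPhase D (fun n => f (n + t + k) - f (n + t)) (k • α) :=
  (hf k).shift t

theorem hasWeylBound_two {c : ℝ} (hc : 0 < c) {μ s : ℝ} (hs : 0 < s) (hμ : 0 ≤ μ)
    (h : 4 * s + 2 * μ < 1) : HasWeylBound c 2 μ s := by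
  obtain ⟨η, hη⟩ : ∃ η, η = 1 - 4 * s - 2 * μ := ⟨_, rfl⟩
  have hη0 : 0 < η := by linarith
  obtain ⟨A, hA⟩ : ∃ A, A = 1 + Real.log (1 / c + 2) + 1 / η := ⟨_, rfl⟩
  have hlog : 0 ≤ Real.log (1 / c + 2) :=
    Real.log_nonneg (by linarith [one_div_pos.mpr hc])
  have hA0 : 0 < A := by rw [hA]; positivity
  refine ⟨12 + 16 * A / c, 1, by positivity, fun L hL ω hω m hm hmL f hf => ?_⟩
  have hL1 : (1 : ℝ) ≤ L := by exact_mod_cast hL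
  have hL0 : (0 : ℝ) < L := by linarith
  have hm' : 0 < |(m : ℝ)| := abs_pos.mpr (by exact_mod_cast hm)
  have hm2 : (0 : ℝ) < (m : ℝ) ^ 2 := by rw [← sq_abs]; positivity
  have hm2L : (m : ℝ) ^ 2 ≤ (L : ℝ) ^ (2 * μ) := by
    calc (m : ℝ) ^ 2 = |(m : ℝ)| ^ 2 := (sq_abs _).symm
      _ ≤ ((L : ℝ) ^ μ) ^ 2 := by gcongr
      _ = (L : ℝ) ^ (2 * μ) := by
          rw [mul_comm, Real.rpow_mul (by positivity)]; norm_cast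
  set β : 𝕋 := m • (ω : 𝕋) with hβ
  set H := ⌊(L : ℝ) ^ (2 * s)⌋₊ with hH
  have hHup : (H : ℝ) ≤ (L : ℝ) ^ (2 * s) := Nat.floor_le (by positivity)
  have hHpos : (0 : ℝ) < H :=
    lt_of_lt_of_le (by positivity) (half_rpow_le_floor hL1 (by linarith : 0 ≤ 2 * s))
  obtain ⟨δ, hδ⟩ : ∃ δ : ℝ, δ = c / (H ^ 2 * (m : ℝ) ^ 2) := ⟨_, rfl⟩
  have hδ0 : 0 < δ := by rw [hδ]; positivity
  have hsep : ∀ k ∈ Finset.Ico 1 H, δ < ‖k • β‖ := by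
    intro k hk
    rw [Finset.mem_Ico] at hk
    have hk0 : (0 : ℝ) < k := by exact_mod_cast hk.1
    have hkH : (k : ℝ) ≤ H := by exact_mod_cast hk.2.le
    have e : k • β = ((k : ℤ) * m) • (ω : 𝕋) := by rw [hβ, mul_smul, natCast_zsmul]
    have h1 := hω.lt_norm_zsmul (k := (k : ℤ) * m)
      (mul_ne_zero (by exact_mod_cast hk0.ne') hm) (by
        push_cast
        rw [abs_mul, abs_of_pos hk0]
        calc (k : ℝ) * |(m : ℝ)| ≤ (L : ℝ) ^ (2 * s) * (L : ℝ) ^ μ := by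
              gcongr
              exact hkH.trans hHup
          _ = (L : ℝ) ^ (2 * s + μ) := (Real.rpow_add hL0 _ _).symm
          _ ≤ (L : ℝ) ^ (1 : ℝ) := Real.rpow_le_rpow_of_exponent_le hL1 (by linarith)
          _ = L := Real.rpow_one _)
    rw [e]
    refine lt_of_le_of_lt ?_ h1
    push_cast
    rw [hδ, mul_pow]
    gcongr
  refine norm_sum_circleChar_le_of_differences f hL hs.le (by linarith) (by positivity)
    (fun k => 1 / ‖k • β‖) ?_ ?_
  · intro k hk t
    rw [le_div_iff₀ (hδ0.trans (hsep k hk))]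
    exact (hf.diff_shift k t).norm_sum_mul_le L
  · have h1 := sum_inv_norm_nsmul_le β H hδ0 hsep
    have hinv : 1 / δ = H ^ 2 * (m : ℝ) ^ 2 / c := by rw [hδ, one_div_div]
    have hH2 : (H : ℝ) ^ 2 ≤ (L : ℝ) ^ (4 * s) := by
      calc (H : ℝ) ^ 2 ≤ ((L : ℝ) ^ (2 * s)) ^ 2 := by gcongr
        _ = (L : ℝ) ^ (2 * s * 2) := by
            rw [Real.rpow_mul (by positivity) (2 * s) 2]; norm_cast
        _ = _ := by ring_nf
    have hinvL : 1 / δ ≤ 1 / c * L := by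
      rw [hinv, div_eq_mul_inv, mul_comm, one_div]
      gcongr
      calc (H : ℝ) ^ 2 * (m : ℝ) ^ 2 ≤ (L : ℝ) ^ (4 * s) * (L : ℝ) ^ (2 * μ) := by gcongr
        _ = (L : ℝ) ^ (4 * s + 2 * μ) := (Real.rpow_add hL0 _ _).symm
        _ ≤ (L : ℝ) ^ (1 : ℝ) := Real.rpow_le_rpow_of_exponent_le hL1 (by linarith)
        _ = L := Real.rpow_one _
    have hLη : (1 : ℝ) ≤ (L : ℝ) ^ η := Real.one_le_rpow hL1 hη0.le
    have hlogA : 1 + Real.log (1 / δ + 2) ≤ A * (L : ℝ) ^ η := by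
      have e1 : Real.log (1 / δ + 2) ≤ Real.log (1 / c + 2) + Real.log L := by
        rw [← Real.log_mul (by positivity) (by positivity)]
        apply Real.log_le_log (by positivity)
        nlinarith
      have e2 := Real.log_le_rpow_div hL0.le hη0
      have e3 : (L : ℝ) ^ η / η = 1 / η * (L : ℝ) ^ η := by ring
      rw [hA]
      nlinarith
    calc 4 * (L : ℝ) / H * ∑ k ∈ Finset.Ico 1 H, 1 / ‖k • β‖
        ≤ 4 * (L : ℝ) / H * (4 / δ * (A * (L : ℝ) ^ η)) := by
          gcongr
          exact h1.trans (by gcongr)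
      _ = 16 * A / c * (L * H * (m : ℝ) ^ 2 * (L : ℝ) ^ η) := by
          rw [show 4 / δ = 4 * (1 / δ) by ring, hinv]
          field_simp
          ring
      _ ≤ 16 * A / c * ((L : ℝ) ^ (1 : ℝ) * (L : ℝ) ^ (2 * s) * (L : ℝ) ^ (2 * μ) *
            (L : ℝ) ^ η) := by
          rw [Real.rpow_one]
          gcongr
      _ = 16 * A / c * (L : ℝ) ^ (2 - 2 * s) := by
          rw [← Real.rpow_add hL0, ← Real.rpow_add hL0, ← Real.rpow_add hL0, hη]
          ring_nf

theorem HasWeylBound.succ {c : ℝ} {D : ℕ} {μ s : ℝ} (hs : 0 < s) (hs' : 4 * s ≤ 1)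
    (h : HasWeylBound c D (μ + 2 * s) (2 * s)) : HasWeylBound c (D + 1) μ s := by
  obtain ⟨K, L₀, hK, hKL⟩ := h
  refine ⟨12 + 4 * K, max L₀ 1, by positivity, fun L hL ω hω m hm hmL f hf => ?_⟩
  have hL1 : (1 : ℝ) ≤ L := by exact_mod_cast (le_max_right _ _).trans hL
  have hL0 : (0 : ℝ) < L := by linarith
  have hHup : (⌊(L : ℝ) ^ (2 * s)⌋₊ : ℝ) ≤ (L : ℝ) ^ (2 * s) := Nat.floor_le (by positivity)
  have hHpos : (0 : ℝ) < ⌊(L : ℝ) ^ (2 * s)⌋₊ :=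
    lt_of_lt_of_le (by positivity) (half_rpow_le_floor hL1 (by linarith : 0 ≤ 2 * s))
  refine norm_sum_circleChar_le_of_differences f ((le_max_right _ _).trans hL) hs.le hs'
    (by positivity) (fun _ => K * (L : ℝ) ^ (1 - 2 * s)) ?_ ?_
  · intro k hk t
    rw [Finset.mem_Ico] at hk
    have hk0 : (0 : ℝ) < k := by exact_mod_cast hk.1
    have hkH : (k : ℝ) ≤ ⌊(L : ℝ) ^ (2 * s)⌋₊ := by exact_mod_cast hk.2.le
    refine hKL L ((le_max_left _ _).trans hL) ω hω (k * m)
      (mul_ne_zero (by exact_mod_cast hk0.ne') hm) ?_ _ ?_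
    · push_cast
      rw [abs_mul, abs_of_pos hk0, add_comm, Real.rpow_add hL0]
      gcongr
      exact hkH.trans hHup
    · rw [mul_smul, natCast_zsmul]
      exact hf.diff_shift k t
  · rw [Finset.sum_const, Nat.card_Ico, nsmul_eq_mul]
    set H := ⌊(L : ℝ) ^ (2 * s)⌋₊
    calc 4 * (L : ℝ) / H * (((H - 1 : ℕ) : ℝ) * (K * (L : ℝ) ^ (1 - 2 * s)))
        ≤ 4 * (L : ℝ) / H * ((H : ℝ) * (K * (L : ℝ) ^ (1 - 2 * s))) := by
          gcongr
          omega
      _ = 4 * K * ((L : ℝ) ^ (1 : ℝ) * (L : ℝ) ^ (1 - 2 * s)) := by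
          rw [Real.rpow_one]
          field_simp
      _ = _ := by
          rw [← Real.rpow_add hL0]
          ring_nf

theorem hasWeylBound_of_two_le {c : ℝ} (hc : 0 < c) {D : ℕ} (hD : 2 ≤ D) {μ s : ℝ} (hs : 0 < s)
    (hμ : 0 ≤ μ) (h : (2 ^ (D + 1) - 4) * s + 2 * μ < 1) : HasWeylBound c D μ s := by
  induction D, hD using Nat.le_induction generalizing μ s with
  | base => exact hasWeylBound_two hc hs hμ (by norm_num at h; linarith)
  | succ D hD ih =>
    have h8 : (8 : ℝ) ≤ 2 ^ (D + 1) := by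
      calc (8 : ℝ) = 2 ^ (2 + 1) := by norm_num
        _ ≤ 2 ^ (D + 1) := pow_le_pow_right₀ (by norm_num) (by omega)
    have h2 : (2 : ℝ) ^ (D + 1 + 1) = 2 * 2 ^ (D + 1) := by ring
    rw [h2] at h
    refine HasWeylBound.succ hs (by nlinarith) (ih (by linarith) (by linarith) ?_)
    linarith

theorem exists_uniform_weylBound {c : ℝ} {d : ℕ} {μ s : ℝ}
    (h : ∀ D, 1 ≤ D → D ≤ d → HasWeylBound c D μ s) :
    ∃ (K : ℝ) (L₀ : ℕ), 0 < K ∧ ∀ D, 1 ≤ D → D ≤ d → ∀ L : ℕ, L₀ ≤ L → ∀ ω : ℝ,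
      IsDiophantineUpTo c L ω → ∀ m : ℤ, m ≠ 0 → |(m : ℝ)| ≤ (L : ℝ) ^ μ →
      ∀ f : ℕ → 𝕋, IsPolyPhase D f (m • (ω : 𝕋)) →
        ‖∑ n ∈ Finset.range L, circleChar (f n)‖ ≤ K * (L : ℝ) ^ (1 - s) := by
  choose K L₀ hK hKL using h
  induction d with
  | zero => exact ⟨1, 0, one_pos, fun D h1 h2 => by omega⟩
  | succ d ih =>
    obtain ⟨K', L', hK', h'⟩ := ih (fun D h1 h2 => K D h1 (by omega))
      (fun D h1 h2 => L₀ D h1 (by omega)) (fun D h1 h2 => hK D h1 (by omega))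
      (fun D h1 h2 => hKL D h1 (by omega))
    refine ⟨max K' (K (d + 1) (by omega) le_rfl), max L' (L₀ (d + 1) (by omega) le_rfl),
      lt_max_of_lt_left hK', fun D h1 h2 L hL ω hω m hm hmL f hf => ?_⟩
    rcases Nat.lt_or_ge d D with hD | hD
    · obtain rfl : D = d + 1 := by omega
      refine (hKL (d + 1) h1 h2 L ((le_max_right _ _).trans hL) ω hω m hm hmL f hf).trans ?_
      gcongr
      exact le_max_right _ _
    · refine (h' D h1 hD L ((le_max_left _ _).trans hL) ω hω m hm hmL f hf).trans ?_
      gcongr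
      exact le_max_left _ _

/-! ### Counting visits to a small box -/

theorem half_card_le_norm_sum_circleChar {d R : ℕ} (hR : 0 < R) (y : Fin d → 𝕋)
    (hy : ∑ k, ‖y k‖ ≤ 1 / (6 * R)) :
    (R : ℝ) ^ d / 2 ≤ ‖∑ j : Fin d → Fin R, circleChar (∑ k, ((j k : ℕ) : ℤ) • y k)‖ := by
  have hR' : (0 : ℝ) < R := by exact_mod_cast hR
  refine le_trans ?_ (Complex.re_le_norm _)
  rw [Complex.re_sum]
  calc (R : ℝ) ^ d / 2 = ∑ j : Fin d → Fin R, (1 / 2 : ℝ) := by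
        simp [div_eq_mul_inv]
    _ ≤ _ := by
        refine Finset.sum_le_sum fun j _ => half_le_re_circleChar ?_
        calc ‖∑ k, ((j k : ℕ) : ℤ) • y k‖ ≤ ∑ k, (R : ℝ) * ‖y k‖ := by
              refine norm_sum_le_of_le _ fun k _ => ?_
              rw [natCast_zsmul]
              refine (norm_nsmul_le).trans ?_
              gcongr
              exact (j k).isLt.le
          _ = R * ∑ k, ‖y k‖ := (Finset.mul_sum _ _ _).symm
          _ ≤ R * (1 / (6 * R)) := by gcongr
          _ = 1 / 6 := by field_simp

theorem card_mul_pow_le_of_expSum_le {d R L : ℕ} (hR : 0 < R) (y : ℕ → Fin d → 𝕋) {B : ℝ}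
    (hB : 0 ≤ B)
    (h : ∀ l : Fin d → ℤ, l ≠ 0 → (∀ k, |l k| ≤ R) →
      ‖∑ n ∈ Finset.range L, circleChar (∑ k, l k • y n k)‖ ≤ B) (s : Finset ℕ)
    (hs : s ⊆ Finset.range L) (hsy : ∀ n ∈ s, ∑ k, ‖y n k‖ ≤ 1 / (6 * R)) :
    (s.card : ℝ) * (R : ℝ) ^ d ≤ 4 * (L + (R : ℝ) ^ d * B) := by
  have hR' : (0 : ℝ) < R := by exact_mod_cast hR
  set Z : ℕ → ℂ := fun n => ∑ j : Fin d → Fin R, circleChar (∑ k, ((j k : ℕ) : ℤ) • y n k) with hZ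
  have h1 : (s.card : ℝ) * ((R : ℝ) ^ d / 2) ^ 2 ≤ ∑ n ∈ Finset.range L, ‖Z n‖ ^ 2 := by
    calc (s.card : ℝ) * ((R : ℝ) ^ d / 2) ^ 2 = ∑ n ∈ s, ((R : ℝ) ^ d / 2) ^ 2 := by simp
      _ ≤ ∑ n ∈ s, ‖Z n‖ ^ 2 := by
          refine Finset.sum_le_sum fun n hn => ?_
          exact pow_le_pow_left₀ (by positivity)
            (half_card_le_norm_sum_circleChar hR (y n) (hsy n hn)) 2
      _ ≤ _ := Finset.sum_le_sum_of_subset_of_nonneg hs fun _ _ _ => by positivity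
  have h2 : ∑ n ∈ Finset.range L, ‖Z n‖ ^ 2 ≤ (R : ℝ) ^ d * (L + (R : ℝ) ^ d * B) := by
    have e1 : ((∑ n ∈ Finset.range L, ‖Z n‖ ^ 2 : ℝ) : ℂ) = ∑ j : Fin d → Fin R,
        ∑ j' : Fin d → Fin R, ∑ n ∈ Finset.range L,
          circleChar (∑ k, (((j k : ℕ) : ℤ) - ((j' k : ℕ) : ℤ)) • y n k) := by
      push_cast
      rw [Finset.sum_congr rfl fun h _ => Finset.sum_comm, Finset.sum_comm]
      refine Finset.sum_congr rfl fun n _ => ?_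
      rw [← Complex.mul_conj', hZ, map_sum, Finset.sum_mul_sum]
      simp only [sub_smul, Finset.sum_sub_distrib, circleChar_sub]
    have e2 : ∑ n ∈ Finset.range L, ‖Z n‖ ^ 2 =
        ‖((∑ n ∈ Finset.range L, ‖Z n‖ ^ 2 : ℝ) : ℂ)‖ := by
      rw [Complex.norm_real, Real.norm_of_nonneg (by positivity)]
    rw [e2, e1]
    refine (norm_sum_le _ _).trans ?_
    calc _ ≤ ∑ j : Fin d → Fin R, ((L : ℝ) + (R : ℝ) ^ d * B) := ?_
      _ = _ := by simp; ring
    refine Finset.sum_le_sum fun j _ => (norm_sum_le _ _).trans ?_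
    rw [← Finset.add_sum_erase _ _ (Finset.mem_univ j)]
    refine add_le_add ?_ ?_
    · simpa using norm_sum_circleChar_le (Finset.range L)
        (fun n => ∑ k, (((j k : ℕ) : ℤ) - ((j k : ℕ) : ℤ)) • y n k)
    · calc _ ≤ ∑ j' ∈ Finset.univ.erase j, B := by
            refine Finset.sum_le_sum fun j' hj' => h _ ?_ ?_
            · intro h0
              refine Finset.ne_of_mem_erase hj' (funext fun k => Fin.ext ?_)
              have := congrFun h0 k
              simp only [Pi.zero_apply] at this
              omega
            · intro k
              have a1 := (j k).isLt
              have a2 := (j' k).isLt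
              rw [abs_le]
              omega
        _ ≤ ∑ j' : Fin d → Fin R, B :=
            Finset.sum_le_sum_of_subset_of_nonneg (Finset.erase_subset _ _) fun _ _ _ => hB
        _ = (R : ℝ) ^ d * B := by simp
  have hRd : (0 : ℝ) < (R : ℝ) ^ d := by positivity
  refine le_of_mul_le_mul_left ?_ hRd
  nlinarith

theorem exponent_lt_one {d : ℕ} (hd : 2 ≤ d) {ρ : ℝ} (hρ : ρ = 1 / ((d + 1) * 2 ^ (d + 1)))
    {D : ℕ} (hD : D ≤ d) : (2 ^ (D + 1) - 4) * (d * ρ) + 2 * (2 * ρ) < 1 := by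
  have hd' : (2 : ℝ) ≤ d := by exact_mod_cast hd
  have hρ0 : 0 < ρ := by rw [hρ]; positivity
  have h1 : (2 : ℝ) ^ (D + 1) ≤ 2 ^ (d + 1) := pow_le_pow_right₀ (by norm_num) (by omega)
  have h2 : (d + 1) * (2 ^ (d + 1) * ρ) = 1 := by rw [hρ]; field_simp
  have h3 : 0 < (2 : ℝ) ^ (d + 1) * ρ := by positivity
  have h4 : (2 : ℝ) ^ (D + 1) * (d * ρ) ≤ 2 ^ (d + 1) * (d * ρ) := by gcongr
  nlinarith

/-- the ergodic property (Lemma 2.1) of the skew shift on `𝕋^d`.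
Here `‖·‖` on `𝕋 = ℝ/ℤ` is the distance to the nearest integer, and
`‖x‖ = ∑ i, ‖x i‖` on `𝕋^d`. -/
theorem statement_2 (d : ℕ) (hd : 2 ≤ d) (c : ℝ) (hc : 0 < c) :
    ∃ (C : ℝ) (L₀ : ℕ), 0 < C ∧
      ∀ L : ℕ, L₀ ≤ L →
      ∀ ω : ℝ, (∀ k : ℤ, k ≠ 0 → |k| ≤ (L : ℤ) → c / (k : ℝ) ^ 2 < ‖((k * ω : ℝ) : 𝕋)‖) →
      ∀ ε : ℝ, (L : ℝ) ^ (-(1 : ℝ) / ((d + 1) * 2 ^ (d + 1))) < ε →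
      ∀ x a : Fin d → 𝕋,
        (({n : ℕ | n ∈ Finset.Icc 1 L ∧
            ∑ i, ‖(skewShift d ω)^[n] x i - a i‖ < ε}.ncard : ℝ)) < C * ε ^ d * L := by
  obtain ⟨ρ, hρ⟩ : ∃ ρ : ℝ, ρ = 1 / ((d + 1) * 2 ^ (d + 1)) := ⟨_, rfl⟩
  have hρ0 : 0 < ρ := by rw [hρ]; positivity
  have hd' : (2 : ℝ) ≤ d := by exact_mod_cast hd
  have hweyl : ∀ D, 1 ≤ D → D ≤ d → HasWeylBound c D (2 * ρ) (d * ρ) := by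
    intro D h1 h2
    rcases h1.eq_or_lt with rfl | h1
    · refine hasWeylBound_one hc (by positivity) ?_
      have := exponent_lt_one hd hρ hd
      norm_num at this
      nlinarith
    · exact hasWeylBound_of_two_le hc h1 (by positivity) (by positivity) (exponent_lt_one hd hρ h2)
  obtain ⟨K, L₀, hK, hKL⟩ := exists_uniform_weylBound hweyl
  refine ⟨4 * (12 ^ d + K) + 6 ^ d + 1, max L₀ 1, by positivity, fun L hL ω hω ε hε x a => ?_⟩
  have hL1 : (1 : ℝ) ≤ L := by exact_mod_cast (le_max_right _ _).trans hL
  have hL0 : (0 : ℝ) < L := by linarith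
  rw [neg_div, ← hρ] at hε
  have hε0 : 0 < ε := lt_trans (by positivity) hε
  have hpos : 0 < ε ^ d * L := by positivity
  classical
  set s : Finset ℕ := (Finset.range L).filter
    (fun n => ∑ i, ‖(skewShift d ω)^[n + 1] x i - a i‖ < ε) with hs
  have hcard : {n : ℕ | n ∈ Finset.Icc 1 L ∧
      ∑ i, ‖(skewShift d ω)^[n] x i - a i‖ < ε}.ncard = s.card := by
    rw [← Finset.card_image_of_injective s (add_left_injective 1), ← Set.ncard_coe_finset]
    congr 1
    ext n
    simp only [Set.mem_ofPred_eq, Finset.mem_Icc, hs, Finset.coe_image, Set.mem_image,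
      Finset.mem_coe, Finset.mem_filter, Finset.mem_range]
    constructor
    · rintro ⟨⟨h1, h2⟩, h3⟩
      exact ⟨n - 1, ⟨by omega, by rwa [Nat.sub_add_cancel h1]⟩, Nat.sub_add_cancel h1⟩
    · rintro ⟨m, ⟨h1, h2⟩, rfl⟩
      exact ⟨⟨by omega, by omega⟩, h2⟩
  rw [hcard]
  have hsL : (s.card : ℝ) ≤ L := by
    have := Finset.card_le_card (Finset.filter_subset _ _ : s ⊆ Finset.range L)
    rw [Finset.card_range] at this
    exact_mod_cast this
  rcases lt_or_ge (1 / 6) ε with hε6 | hε6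
  · have h1 : (1 : ℝ) ≤ 6 ^ d * ε ^ d := by
      rw [← mul_pow]
      exact one_le_pow₀ (by linarith)
    have h2 : 0 ≤ 4 * (12 ^ d + K) * (ε ^ d * L) := by positivity
    nlinarith
  set R : ℕ := ⌊1 / (6 * ε)⌋₊ with hR
  have hR1 : 1 ≤ R := Nat.le_floor (by
    rw [Nat.cast_one, le_div_iff₀ (by positivity)]
    linarith)
  have hR0 : (0 : ℝ) < R := by exact_mod_cast hR1
  have hRup : (R : ℝ) ≤ 1 / (6 * ε) := Nat.floor_le (by positivity)
  have hRlow : 1 ≤ R * (12 * ε) := by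
    have h1 := Nat.lt_floor_add_one (1 / (6 * ε))
    have h2 : (1 : ℝ) ≤ R := by exact_mod_cast hR1
    rw [← hR, div_lt_iff₀ (by positivity)] at h1
    nlinarith
  have hRL : (R : ℝ) ≤ (L : ℝ) ^ (2 * ρ) := by
    have h1 : 1 / ε ≤ (L : ℝ) ^ ρ := by
      rw [Real.rpow_neg hL0.le] at hε
      rw [one_div]
      exact inv_le_of_inv_le₀ (by positivity) hε.le
    have h2 : (L : ℝ) ^ ρ ≤ (L : ℝ) ^ (2 * ρ) :=
      Real.rpow_le_rpow_of_exponent_le hL1 (by linarith)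
    have h3 : 1 / (6 * ε) ≤ 1 / ε := by
      gcongr
      linarith
    linarith
  have hcount := card_mul_pow_le_of_expSum_le (d := d) (L := L) hR1
    (fun n k => (skewShift d ω)^[n + 1] x k - a k) (B := K * (L : ℝ) ^ (1 - d * ρ))
    (by positivity) (by
      intro l hl hlR
      obtain ⟨i, hi, hphase⟩ := exists_isPolyPhase_sum_smul_skewShift ω x a l hl
      refine hKL (d - i) (by omega) (by omega) L ((le_max_left _ _).trans hL) ω hω (l i) hi ?_ _
        (hphase.shift 1)
      refine le_trans ?_ hRL
      exact_mod_cast hlR i) s (Finset.filter_subset _ _) (by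
      intro n hn
      refine (Finset.mem_filter.mp hn).2.le.trans ?_
      rw [le_div_iff₀ (by positivity)]
      rw [le_div_iff₀ (by positivity)] at hRup
      linarith)
  have hLρ : (L : ℝ) ^ (1 - d * ρ) ≤ ε ^ d * L := by
    calc (L : ℝ) ^ (1 - d * ρ) = ((L : ℝ) ^ (-ρ)) ^ d * L := by
          rw [← Real.rpow_natCast ((L : ℝ) ^ (-ρ)) d, ← Real.rpow_mul hL0.le,
            ← Real.rpow_add_one hL0.ne']
          ring_nf
      _ ≤ ε ^ d * L := by gcongr
  have hRd : (0 : ℝ) < (R : ℝ) ^ d := by positivity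
  have hRlow' : (1 : ℝ) ≤ (R : ℝ) ^ d * (12 ^ d * ε ^ d) := by
    rw [← mul_pow, ← mul_pow]
    exact one_le_pow₀ hRlow
  have hfin : (s.card : ℝ) ≤ 4 * (12 ^ d + K) * (ε ^ d * L) := by
    refine le_of_mul_le_mul_right ?_ hRd
    calc (s.card : ℝ) * (R : ℝ) ^ d ≤ 4 * (L + (R : ℝ) ^ d * (K * (L : ℝ) ^ (1 - d * ρ))) := hcount
      _ ≤ 4 * ((R : ℝ) ^ d * (12 ^ d * ε ^ d) * L + (R : ℝ) ^ d * (K * (ε ^ d * L))) := by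
          gcongr
          exact le_mul_of_one_le_left hL0.le hRlow'
      _ = _ := by ring
  have h6 : 0 ≤ (6 : ℝ) ^ d * (ε ^ d * L) := by positivity
  linarith
end
end

section
/- For every n ≥ 1 there is a constant C = C(n) such that: if S ⊂ ℝ^n is a semi-algebraic set of degree at most B (B ≥ 2), then the number of connected components of S is at most B^C. -/
open MeasureTheory

noncomputable section

/-- A basic cell of a semi-algebraic set: the sign conditions `0, 1, 2 : Fin 3` encode
`P(x) ≤ 0`, `P(x) = 0`, `P(x) ≥ 0` respectively. -/
def SAcell {n s : ℕ} (P : Fin s → MvPolynomial (Fin n) ℝ)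
    (c : Finset (Fin s) × (Fin s → Fin 3)) : Set (Fin n → ℝ) :=
  {x | ∀ l ∈ c.1,
      (c.2 l = 0 → MvPolynomial.eval x (P l) ≤ 0) ∧
      (c.2 l = 1 → MvPolynomial.eval x (P l) = 0) ∧
      (c.2 l = 2 → 0 ≤ MvPolynomial.eval x (P l))}

/-- `S ⊆ ℝⁿ` is semi-algebraic of degree at most `B`: it is a finite union of cells cut out by
`s` polynomials of degree at most `d₀`, with `s·d₀ ≤ B`. -/
def IsSemialgebraic (n : ℕ) (B : ℝ) (S : Set (Fin n → ℝ)) : Prop :=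
  ∃ (s d₀ : ℕ) (P : Fin s → MvPolynomial (Fin n) ℝ)
    (𝒞 : Finset (Finset (Fin s) × (Fin s → Fin 3))),
      (∀ i, (P i).totalDegree ≤ d₀) ∧ ((s : ℝ) * (d₀ : ℝ) ≤ B) ∧
      S = ⋃ cc ∈ 𝒞, SAcell P cc

namespace MvPolynomial

/-- A system `x i ^ m = q i (x)` with all `q i` of total degree less than `m` has at most
`m ^ |σ|` solutions: evaluation at the solutions factors through the span of the monomials
all of whose exponents are less than `m`. -/
theorem card_le_pow_of_pow_eq_eval {σ K : Type*} [Fintype σ] [Field K] {m : ℕ}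
    (q : σ → MvPolynomial σ K) (hq : ∀ i, (q i).totalDegree < m) (Y : Finset (σ → K))
    (hY : ∀ x ∈ Y, ∀ i, x i ^ m = eval x (q i)) :
    Y.card ≤ m ^ Fintype.card σ := by
  classical
  let ev : MvPolynomial σ K →ₗ[K] (Y → K) :=
    LinearMap.pi fun y => (aeval (R := K) y.1).toLinearMap
  have ev_apply (p : MvPolynomial σ K) (y : Y) : ev p y = eval y.1 p := by
    simp [ev, aeval_eq_eval]
  let b : (σ → Fin m) → (Y → K) := fun a y => ∏ i, y.1 i ^ (a i : ℕ)
  have hspan (N : ℕ) : ∀ p : MvPolynomial σ K, p.totalDegree ≤ N →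
      ev p ∈ Submodule.span K (Set.range b) := by
    induction N using Nat.strong_induction_on with
    | _ N ih =>
      intro p hp
      rw [p.as_sum, map_sum]
      refine Submodule.sum_mem _ fun a ha => ?_
      have haN : (a.sum fun _ e => e) ≤ N := (le_totalDegree ha).trans hp
      by_cases hlt : ∀ i, a i < m
      · have : ev (monomial a (coeff a p)) = coeff a p • b fun i => ⟨a i, hlt i⟩ := by
          ext y
          simp [ev_apply, b, eval_monomial, Finsupp.prod_fintype]
        rw [this]
        exact Submodule.smul_mem _ _ (Submodule.subset_span ⟨_, rfl⟩)
      · push Not at hlt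
        obtain ⟨i, hi⟩ := hlt
        obtain ⟨a', rfl⟩ : ∃ a', a = a' + Finsupp.single i m :=
          ⟨a - Finsupp.single i m, (tsub_add_cancel_of_le (by simpa using hi)).symm⟩
        have : ev (monomial (a' + Finsupp.single i m) (coeff (a' + Finsupp.single i m) p)) =
            ev (monomial a' (coeff (a' + Finsupp.single i m) p) * q i) := by
          ext y
          rw [ev_apply, ev_apply, monomial_add_single, map_mul, map_mul, map_pow, eval_X,
            hY y.1 y.2 i]
        rw [this]
        rw [Finsupp.sum_add_index' (by simp) (by simp), Finsupp.sum_single_index rfl] at haN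
        refine ih _ ?_ _ le_rfl
        calc _ ≤ (monomial a' (coeff (a' + Finsupp.single i m) p)).totalDegree
                + (q i).totalDegree := totalDegree_mul _ _
          _ < (a'.sum fun _ e => e) + m := by
            have := totalDegree_monomial_le a' (coeff (a' + Finsupp.single i m) p)
            have hid : (a'.sum fun _ => id) = a'.sum fun _ e => e := rfl
            have := hq i
            omega
          _ ≤ N := haN
  have hsurj : Submodule.span K (Set.range b) = ⊤ := by
    rw [eq_top_iff]
    intro f _
    have key (x : Y) : (Pi.single x 1 : Y → K) ∈ Submodule.span K (Set.range b) := by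
      have hsep (y : σ → K) : ∃ p : MvPolynomial σ K, eval y p = 0 ∧ (y ≠ x → eval x.1 p ≠ 0) := by
        by_cases h : y = x
        · exact ⟨0, by simp, fun h' => absurd h h'⟩
        · obtain ⟨i, hi⟩ := Function.ne_iff.1 h
          exact ⟨X i - C (y i), by simp, fun _ => by simpa [sub_eq_zero] using hi.symm⟩
      choose p hp0 hp1 using hsep
      let P := ∏ y ∈ Y.erase x, p y
      have hPx : eval x.1 P ≠ 0 := by
        rw [map_prod, Finset.prod_ne_zero_iff]
        exact fun y hy => hp1 y (Finset.ne_of_mem_erase hy)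
      have : (Pi.single x 1 : Y → K) = (eval x.1 P)⁻¹ • ev P := by
        ext y
        rw [Pi.smul_apply, ev_apply, smul_eq_mul]
        by_cases h : y = x
        · subst h
          simp [hPx]
        · have : eval y.1 P = 0 := by
            rw [map_prod]
            exact Finset.prod_eq_zero (Finset.mem_erase.2 ⟨fun h' => h (Subtype.ext h'), y.2⟩)
              (hp0 y.1)
          simp [h, this]
      rw [this]
      exact Submodule.smul_mem _ _ (hspan _ _ le_rfl)
    rw [pi_eq_sum_univ' f]
    exact Submodule.sum_mem _ fun x _ => Submodule.smul_mem _ _ (key x)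
  have h := finrank_range_le_card (R := K) b
  rw [Set.finrank, hsurj, finrank_top] at h
  simpa using h

theorem hasDerivAt_eval_update {σ : Type*} [DecidableEq σ] (p : MvPolynomial σ ℝ) (x : σ → ℝ)
    (i : σ) (r : ℝ) :
    HasDerivAt (fun t => eval (Function.update x i t) p)
      (eval (Function.update x i r) (pderiv i p)) r := by
  induction p using MvPolynomial.induction_on with
  | C a => simpa using hasDerivAt_const r a
  | add p q hp hq =>
    simp only [map_add]
    exact hp.add hq
  | mul_X p j hp =>
    have hX : HasDerivAt (fun t => Function.update x i t j)
        (Pi.single (M := fun _ => ℝ) i 1 j) r :=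
      hasDerivAt_pi.1 (hasDerivAt_update x i r) j
    have hsingle : eval (Function.update x i r)
        (Pi.single (M := fun _ => MvPolynomial σ ℝ) i 1 j) =
        Pi.single (M := fun _ => ℝ) i 1 j := by
      by_cases h : j = i
      · subst h; simp
      · simp [h]
    simp only [pderiv_mul, pderiv_X, map_add, map_mul, eval_X, hsingle]
    exact hp.mul hX

theorem eval_pderiv_eq_zero_of_isLocalMin {σ : Type*} (p : MvPolynomial σ ℝ)
    {x : σ → ℝ} (h : IsLocalMin (fun y => eval y p) x) (i : σ) : eval x (pderiv i p) = 0 := by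
  classical
  have hd := hasDerivAt_eval_update p x i (x i)
  rw [Function.update_eq_self] at hd
  have hc : ContinuousAt (fun t => Function.update x i t) (x i) :=
    (continuous_const.update i continuous_id).continuousAt
  have h' : IsLocalMin (fun y => eval y p) (Function.update x i (x i)) := by
    rwa [Function.update_eq_self]
  exact (h'.comp_continuous hc).hasDerivAt_eq_zero hd

theorem totalDegree_pderiv_le {σ R : Type*} [CommSemiring R] (i : σ) (p : MvPolynomial σ R) :
    (pderiv i p).totalDegree ≤ p.totalDegree := by
  classical
  rw [p.as_sum, map_sum]
  refine totalDegree_finsetSum_le fun a ha => ?_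
  rw [← p.as_sum, pderiv_monomial]
  refine (totalDegree_monomial_le _ _).trans (le_trans ?_ (le_totalDegree ha))
  exact Finsupp.degree_mono tsub_le_self

/-- The perturbation `p + t ∑ i, X i ^ (m + 1)` of a polynomial `p` of total degree less than `m`
has at most `m ^ |σ|` critical points. -/
theorem card_le_pow_of_isLocalMin {σ : Type*} [Fintype σ] {m : ℕ}
    (p : MvPolynomial σ ℝ) (hp : p.totalDegree < m) {t : ℝ} (ht : t ≠ 0) (Y : Finset (σ → ℝ))
    (hY : ∀ x ∈ Y, IsLocalMin (fun y => eval y p + t * ∑ i, y i ^ (m + 1)) x) :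
    Y.card ≤ m ^ Fintype.card σ := by
  classical
  have hc : t * (m + 1) ≠ 0 := mul_ne_zero ht (by positivity)
  refine card_le_pow_of_pow_eq_eval (fun i => C (-(t * (m + 1))⁻¹) * pderiv i p) (fun i => ?_) Y
    fun x hx i => ?_
  · refine lt_of_le_of_lt (totalDegree_mul _ _) ?_
    rw [totalDegree_C, zero_add]
    exact (totalDegree_pderiv_le i p).trans_lt hp
  · have h := eval_pderiv_eq_zero_of_isLocalMin (p + C t * ∑ i, X i ^ (m + 1)) (x := x)
      (by simpa using hY x hx) i
    have hs : eval x (pderiv i (∑ j, (X j : MvPolynomial σ ℝ) ^ (m + 1))) =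
        (m + 1) * x i ^ m := by
      rw [map_sum, map_sum, Finset.sum_eq_single i]
      · simp
      · intro j _ hj
        simp [pderiv_X_of_ne hj]
      · simp
    rw [map_add, map_add, pderiv_C_mul, map_mul, hs, eval_C] at h
    rw [map_mul, eval_C]
    field_simp
    linarith

end MvPolynomial

theorem Nat.card_connectedComponents_le_of_forall_isClopen {X : Type*} [TopologicalSpace X]
    {N : ℕ}
    (h : ∀ (k : ℕ) (U : Fin k → Set X), (∀ i, IsClopen (U i)) → (∀ i, (U i).Nonempty) →
      Pairwise (Function.onFun Disjoint U) → ⋃ i, U i = Set.univ → k ≤ N) :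
    Finite (ConnectedComponents X) ∧ Nat.card (ConnectedComponents X) ≤ N := by
  have hfin : Finite (ConnectedComponents X) := by
    by_contra hinf
    rw [not_finite_iff_infinite] at hinf
    obtain ⟨U, h1, h2, h3, h4⟩ := ConnectedComponents.exists_fun_isClopen_of_infinite X (N + 1) (by simp)
    exact absurd (h _ U h1 h2 h3 h4) (by simp)
  refine ⟨hfin, ?_⟩
  cases nonempty_fintype (ConnectedComponents X)
  rw [Nat.card_eq_fintype_card]
  refine h _ (fun i => ConnectedComponents.mk ⁻¹' {(Fintype.equivFin _).symm i}) (fun i => ?_)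
    (fun i => ?_) (fun i j hij => Disjoint.preimage _ (by simp [hij])) ?_
  · exact (isClopen_discrete _).preimage ConnectedComponents.continuous_coe
  · exact (Set.singleton_nonempty _).preimage ConnectedComponents.surjective_coe
  · simp [← Set.preimage_iUnion]

theorem exists_isOpen_superset_pairwise_disjoint {ι X : Type*} [Finite ι] [PseudoEMetricSpace X]
    {D : ι → Set X} (hD : ∀ i, IsClosed (D i)) (hdisj : Pairwise (Function.onFun Disjoint D)) :
    ∃ V : ι → Set X, (∀ i, IsOpen (V i)) ∧ (∀ i, D i ⊆ V i) ∧
      Pairwise (Function.onFun Disjoint V) := by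
  refine ⟨fun i => ⋂ j, ⋂ _ : j ≠ i, {x | Metric.infEDist x (D i) < Metric.infEDist x (D j)},
    fun i => ?_, fun i x hx => ?_, fun i j hij => ?_⟩
  · exact isOpen_iInter_of_finite fun j => isOpen_iInter_of_finite fun _ =>
      isOpen_lt Metric.continuous_infEDist Metric.continuous_infEDist
  · simp only [Set.mem_iInter, Set.mem_ofPred_eq]
    intro j hj
    rw [Metric.infEDist_zero_of_mem hx]
    refine pos_iff_ne_zero.2 fun h0 => ?_
    exact (hdisj hj.symm).notMem_of_mem_left hx
      ((Metric.mem_iff_infEDist_zero_of_closed (hD j)).2 h0)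
  · refine Set.disjoint_left.2 fun x hx hx' => ?_
    simp only [Set.mem_iInter, Set.mem_ofPred_eq] at hx hx'
    exact lt_asymm (hx j hij.symm) (hx' i hij)

/-- The cell `SAcell P c` with all its sign conditions relaxed by `ε`. -/
def relaxedCell {n s : ℕ} (P : Fin s → MvPolynomial (Fin n) ℝ)
    (c : Finset (Fin s) × (Fin s → Fin 3)) (ε : ℝ) : Set (Fin n → ℝ) :=
  {x | ∀ l ∈ c.1,
      (c.2 l = 0 → MvPolynomial.eval x (P l) ≤ ε) ∧
      (c.2 l = 1 → |MvPolynomial.eval x (P l)| ≤ ε) ∧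
      (c.2 l = 2 → -ε ≤ MvPolynomial.eval x (P l))}

section relaxedCell

variable {n s : ℕ} (P : Fin s → MvPolynomial (Fin n) ℝ) (c : Finset (Fin s) × (Fin s → Fin 3))

theorem relaxedCell_zero : relaxedCell P c 0 = SAcell P c := by
  simp [relaxedCell, SAcell]

theorem relaxedCell_mono {ε δ : ℝ} (h : ε ≤ δ) : relaxedCell P c ε ⊆ relaxedCell P c δ :=
  fun _ hx l hl => ⟨fun h0 => ((hx l hl).1 h0).trans h, fun h1 => ((hx l hl).2.1 h1).trans h,
    fun h2 => (neg_le_neg h).trans ((hx l hl).2.2 h2)⟩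

theorem isClosed_setOf_mem_relaxedCell :
    IsClosed {z : ℝ × (Fin n → ℝ) | z.2 ∈ relaxedCell P c z.1} := by
  have hc (l : Fin s) : Continuous fun z : ℝ × (Fin n → ℝ) => MvPolynomial.eval z.2 (P l) :=
    (MvPolynomial.continuous_eval (P l)).comp continuous_snd
  change IsClosed {z : ℝ × (Fin n → ℝ) | ∀ l ∈ c.1,
      (c.2 l = 0 → MvPolynomial.eval z.2 (P l) ≤ z.1) ∧
      (c.2 l = 1 → |MvPolynomial.eval z.2 (P l)| ≤ z.1) ∧
      (c.2 l = 2 → -z.1 ≤ MvPolynomial.eval z.2 (P l))}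
  simp only [Set.ofPred_forall, Set.ofPred_and]
  refine isClosed_iInter fun l => isClosed_iInter fun _ =>
    .inter (isClosed_iInter fun _ => ?_) (.inter (isClosed_iInter fun _ => ?_)
      (isClosed_iInter fun _ => ?_))
  · exact isClosed_le (hc l) continuous_fst
  · exact isClosed_le (hc l).abs continuous_fst
  · exact isClosed_le continuous_fst.neg (hc l)

theorem isClosed_relaxedCell (ε : ℝ) : IsClosed (relaxedCell P c ε) :=
  (isClosed_setOf_mem_relaxedCell P c).preimage (Continuous.prodMk_right ε)

/-- A relaxed cell is a neighborhood of each of its points at which no condition is sharp. -/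
theorem relaxedCell_mem_nhds {ε : ℝ} {x : Fin n → ℝ} (hx : x ∈ relaxedCell P c ε)
    (hne : ∀ l, MvPolynomial.eval x (P l) ^ 2 ≠ ε ^ 2) : relaxedCell P c ε ∈ nhds x := by
  have hcont (l : Fin s) : ContinuousAt (fun y => MvPolynomial.eval y (P l)) x :=
    (MvPolynomial.continuous_eval (P l)).continuousAt
  have hlt {a b : ℝ} (h : a ≤ b) (hab : a ^ 2 ≠ b ^ 2) : a < b :=
    h.lt_of_ne fun h' => hab (by rw [h'])
  refine (Filter.eventually_all_finset c.1).2 fun l hl => ?_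
  obtain ⟨h0, h1, h2⟩ := hx l hl
  refine .and ?_ (.and ?_ ?_) <;> rw [Filter.eventually_imp_distrib_left] <;> intro h
  · exact ((hcont l).eventually_lt_const (hlt (h0 h) (hne l))).mono fun _ => le_of_lt
  · exact ((hcont l).abs.eventually_lt_const
      (hlt (h1 h) (by rw [sq_abs]; exact hne l))).mono fun _ => le_of_lt
  · exact ((hcont l).eventually_const_lt
      (hlt (h2 h) (by rw [neg_sq]; exact (hne l).symm))).mono fun _ => le_of_lt

end relaxedCell

theorem eventually_ne_sq_nhdsGT_zero (a : ℝ) :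
    ∀ᶠ ε in nhdsWithin (0 : ℝ) (Set.Ioi 0), a ^ 2 ≠ ε ^ 2 := by
  by_cases ha : a = 0
  · filter_upwards [self_mem_nhdsWithin] with ε hε
    have : 0 < ε := hε
    rw [ha, zero_pow two_ne_zero]
    exact (pow_pos this 2).ne
  · filter_upwards [Ioo_mem_nhdsGT (abs_pos.2 ha)] with ε hε h
    rw [sq_eq_sq_iff_abs_eq_abs, abs_of_pos hε.1] at h
    exact hε.2.ne' h

theorem isCompact_sum_sq_le {ι : Type*} [Fintype ι] (M : ℝ) :
    IsCompact {x : ι → ℝ | ∑ i, x i ^ 2 ≤ M} := by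
  have hcont : Continuous fun x : ι → ℝ => ∑ i, x i ^ 2 := by fun_prop
  refine (isCompact_univ_pi fun _ : ι => isCompact_Icc (a := -√M) (b := √M)).of_isClosed_subset
    (isClosed_le hcont continuous_const) fun x hx i _ => ?_
  rw [Set.mem_Icc, ← abs_le]
  exact Real.abs_le_sqrt ((Finset.single_le_sum (f := fun i => x i ^ 2)
    (fun j _ => sq_nonneg _) (Finset.mem_univ i)).trans hx)

open MvPolynomial in
/-- A finite union of cells cut out by `s` polynomials of degree at most `d` cannot be
partitioned into more than `(4sd + 5)ⁿ` nonempty closed sets. -/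
theorem card_le_of_iUnion_SAcell_eq {n s d : ℕ} {P : Fin s → MvPolynomial (Fin n) ℝ}
    (hP : ∀ l, (P l).totalDegree ≤ d) (𝒞 : Finset (Finset (Fin s) × (Fin s → Fin 3)))
    {k : ℕ} (D : Fin k → Set (Fin n → ℝ)) (hclosed : ∀ i, IsClosed (D i))
    (hne : ∀ i, (D i).Nonempty) (hdisj : Pairwise (Function.onFun Disjoint D))
    (hD : ⋃ i, D i = ⋃ c ∈ 𝒞, SAcell P c) : k ≤ (4 * (s * d) + 5) ^ n := by
  obtain ⟨V, hVopen, hDV, hVdisj⟩ := exists_isOpen_superset_pairwise_disjoint hclosed hdisj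
  choose z hz using hne
  have hcontN : Continuous fun x : Fin n → ℝ => ∑ i, x i ^ 2 := by fun_prop
  obtain ⟨M, hM⟩ : ∃ M : ℝ, ∀ i, ∑ j, z i j ^ 2 < M := by
    obtain ⟨M, hM⟩ := (Set.finite_range fun i => ∑ j, z i j ^ 2).bddAbove
    exact ⟨M + 1, fun i => (hM ⟨i, rfl⟩).trans_lt (lt_add_one M)⟩
  -- outside the `V i`, the ball of radius `√M` is disjoint from the relaxed set
  have hT : IsCompact ({x : Fin n → ℝ | ∑ i, x i ^ 2 ≤ M} \ ⋃ i, V i) :=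
    (isCompact_sum_sq_le M).diff (isOpen_iUnion hVopen)
  have hev : ∀ᶠ ε in nhds (0 : ℝ), ∀ x ∈ {x : Fin n → ℝ | ∑ i, x i ^ 2 ≤ M} \ ⋃ i, V i,
      ∀ c ∈ 𝒞, x ∉ relaxedCell P c ε := by
    refine hT.eventually_forall_of_forall_eventually fun x hx => ?_
    refine (Filter.eventually_all_finset 𝒞).2 fun c hc => ?_
    refine (isClosed_setOf_mem_relaxedCell P c).isOpen_compl.mem_nhds fun hmem => hx.2 ?_
    have hxS : x ∈ ⋃ i, D i := by
      rw [hD]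
      exact Set.mem_biUnion hc (by rw [← relaxedCell_zero]; exact hmem)
    exact Set.iUnion_mono hDV hxS
  obtain ⟨ε, hεT, hεz, hε0⟩ : ∃ ε : ℝ,
      (∀ x ∈ {x : Fin n → ℝ | ∑ i, x i ^ 2 ≤ M} \ ⋃ i, V i, ∀ c ∈ 𝒞, x ∉ relaxedCell P c ε) ∧
      (∀ i l, eval (z i) (P l) ^ 2 ≠ ε ^ 2) ∧ 0 < ε :=
    ((hev.filter_mono nhdsWithin_le_nhds).and ((Filter.eventually_all.2 fun i =>
      Filter.eventually_all.2 fun l => eventually_ne_sq_nhdsGT_zero _).and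
      self_mem_nhdsWithin)).exists
  let F : MvPolynomial (Fin n) ℝ :=
    (C M - ∑ i, X i ^ 2) * ∏ l, (P l ^ 2 - C (ε ^ 2))
  have hF (x : Fin n → ℝ) : eval x F =
      (M - ∑ i, x i ^ 2) * ∏ l, (eval x (P l) ^ 2 - ε ^ 2) := by
    simp [F, map_prod]
  have hFdeg : (-F ^ 2).totalDegree < 4 * (s * d) + 5 := by
    have h1 : (C M - ∑ i, X i ^ 2 : MvPolynomial (Fin n) ℝ).totalDegree ≤ 2 := by
      refine (totalDegree_sub _ _).trans (max_le (by simp) (totalDegree_finsetSum_le fun i _ => ?_))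
      simp
    have h2 : (∏ l, (P l ^ 2 - C (ε ^ 2))).totalDegree ≤ s * (2 * d) := by
      refine (totalDegree_finsetProd _ _).trans ((Finset.sum_le_card_nsmul _ _ (2 * d)
        fun l _ => ?_).trans (by simp))
      exact (totalDegree_sub_C_le _ _).trans ((totalDegree_pow _ _).trans
        (Nat.mul_le_mul_left 2 (hP l)))
    have h3 : F.totalDegree ≤ 2 + s * (2 * d) := (totalDegree_mul _ _).trans (add_le_add h1 h2)
    rw [totalDegree_neg]
    refine (totalDegree_pow _ _).trans_lt ?_
    calc 2 * F.totalDegree ≤ 2 * (2 + s * (2 * d)) := Nat.mul_le_mul_left 2 h3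
      _ = 4 * (s * d) + 4 := by ring
      _ < _ := Nat.lt_succ_self _
  let φ : (Fin n → ℝ) → ℝ := fun x => ∑ i, x i ^ (4 * (s * d) + 5 + 1)
  have hφ (x : Fin n → ℝ) : 0 ≤ φ x :=
    Finset.sum_nonneg fun i _ => Even.pow_nonneg ⟨2 * (s * d) + 3, by ring⟩ _
  obtain ⟨t, htz, ht0⟩ : ∃ t : ℝ, (∀ i, eval (z i) (-F ^ 2) + t * φ (z i) < 0) ∧ 0 < t := by
    have hzF (i : Fin k) : eval (z i) (-F ^ 2) + 0 * φ (z i) < 0 := by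
      have : eval (z i) F ≠ 0 := by
        rw [hF]
        exact mul_ne_zero (sub_pos.2 (hM i)).ne'
          (Finset.prod_ne_zero_iff.2 fun l _ => sub_ne_zero.2 (hεz i l))
      rw [map_neg, map_pow, zero_mul, add_zero, neg_lt_zero]
      positivity
    have hcont (i : Fin k) : Continuous fun t : ℝ => eval (z i) (-F ^ 2) + t * φ (z i) := by
      fun_prop
    have hall : ∀ᶠ t in nhds (0 : ℝ), ∀ i, eval (z i) (-F ^ 2) + t * φ (z i) < 0 :=
      Filter.eventually_all.2 fun i => (hcont i).continuousAt.eventually_lt_const (hzF i)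
    exact ((hall.filter_mono nhdsWithin_le_nhds).and
      (self_mem_nhdsWithin (s := Set.Ioi 0))).exists
  let G : (Fin n → ℝ) → ℝ := fun x => eval x (-F ^ 2) + t * φ x
  have hG : Continuous G := by
    have := MvPolynomial.continuous_eval (-F ^ 2)
    fun_prop
  let R : Set (Fin n → ℝ) := {x | ∑ i, x i ^ 2 ≤ M} ∩ ⋃ c ∈ 𝒞, relaxedCell P c ε
  have hR : IsCompact R := (isCompact_sum_sq_le M).inter_right
    (𝒞.finite_toSet.isClosed_biUnion fun c _ => isClosed_relaxedCell P c ε)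
  have hRV : R ⊆ ⋃ i, V i := by
    rintro x ⟨hxM, hxR⟩
    by_contra hxV
    obtain ⟨c, hc, hxc⟩ := Set.mem_iUnion₂.1 hxR
    exact hεT x ⟨hxM, hxV⟩ c hc hxc
  have hRi (i : Fin k) : IsCompact (R ∩ V i) := by
    have : R ∩ V i = R \ ⋃ j, ⋃ _ : j ≠ i, V j := by
      ext x
      simp only [Set.mem_inter_iff, Set.mem_sdiff, Set.mem_iUnion, not_exists]
      refine and_congr_right fun hx => ⟨fun hi j hj hxj => ?_, fun h => ?_⟩
      · exact (hVdisj hj).notMem_of_mem_left hxj hi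
      · obtain ⟨j, hj⟩ := Set.mem_iUnion.1 (hRV hx)
        by_cases hji : j = i
        · exact hji ▸ hj
        · exact absurd hj (h j hji)
    rw [this]
    exact hR.diff (isOpen_iUnion fun j => isOpen_iUnion fun _ => hVopen j)
  have hzR (i : Fin k) : z i ∈ R ∩ V i := by
    refine ⟨⟨(hM i).le, ?_⟩, hDV i (hz i)⟩
    have : z i ∈ ⋃ c ∈ 𝒞, SAcell P c := hD ▸ Set.mem_iUnion_of_mem i (hz i)
    refine Set.iUnion₂_mono (fun c _ => ?_) this
    rw [← relaxedCell_zero]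
    exact relaxedCell_mono P c hε0.le
  have hmin (i : Fin k) : ∃ y ∈ V i, IsLocalMin G y := by
    obtain ⟨y, ⟨⟨hyM, hyR⟩, hyV⟩, hymin⟩ :=
      (hRi i).exists_isMinOn ⟨z i, hzR i⟩ hG.continuousOn
    refine ⟨y, hyV, hymin.isLocalMin ?_⟩
    have hFy : eval y F ≠ 0 := by
      intro h0
      have h1 : G y ≤ G (z i) := hymin (hzR i)
      have h2 : G y = t * φ y := by simp [G, h0]
      have h3 := mul_nonneg ht0.le (hφ y)
      have h4 : G (z i) < 0 := htz i
      linarith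
    rw [hF, mul_ne_zero_iff, Finset.prod_ne_zero_iff] at hFy
    have hyM' : ∑ i, y i ^ 2 < M := lt_of_le_of_ne hyM fun h => hFy.1 (by rw [h, sub_self])
    obtain ⟨c, hc, hyc⟩ := Set.mem_iUnion₂.1 hyR
    have hnhds := relaxedCell_mem_nhds P c hyc fun l =>
      sub_ne_zero.1 (hFy.2 l (Finset.mem_univ l))
    refine Filter.inter_mem (Filter.inter_mem ?_ ?_) ((hVopen i).mem_nhds hyV)
    · exact (hcontN.continuousAt.eventually_lt_const hyM').mono fun _ => le_of_lt
    · exact Filter.mem_of_superset hnhds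
        (Set.subset_biUnion_of_mem (u := fun c => relaxedCell P c ε) hc)
  choose y hyV hymin using hmin
  have hyinj : Function.Injective y := fun i j hij => by
    by_contra hne
    exact (hVdisj hne).notMem_of_mem_left (hyV i) (hij ▸ hyV j)
  have hcard := card_le_pow_of_isLocalMin (-F ^ 2) hFdeg ht0.ne'
    (Finset.univ.map ⟨y, hyinj⟩) fun x hx => by
      obtain ⟨i, -, rfl⟩ := Finset.mem_map.1 hx
      exact hymin i
  simpa using hcard

/-- a semi-algebraic set of degree at most `B` has at most `B^C` connected
components. -/
theorem statement_12 (n : ℕ) (hn : 1 ≤ n) :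
    ∃ C : ℝ, 0 < C ∧
      ∀ B : ℝ, 2 ≤ B → ∀ S : Set (Fin n → ℝ), IsSemialgebraic n B S →
        Finite (ConnectedComponents S) ∧
        (Nat.card (ConnectedComponents S) : ℝ) ≤ B ^ C := by
  refine ⟨(4 * n : ℕ), by positivity, fun B hB S ⟨s, d, P, 𝒞, hP, hsd, hS⟩ => ?_⟩
  have hSclosed : IsClosed S := by
    rw [hS]
    refine 𝒞.finite_toSet.isClosed_biUnion fun c _ => ?_
    rw [← relaxedCell_zero]
    exact isClosed_relaxedCell P c 0
  obtain ⟨hfin, hcard⟩ := Nat.card_connectedComponents_le_of_forall_isClopen (X := S)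
    (N := (4 * (s * d) + 5) ^ n) fun k U hU hne hdisj hcover => by
      refine card_le_of_iUnion_SAcell_eq hP 𝒞 (fun i => Subtype.val '' U i)
        (fun i => hSclosed.isClosedEmbedding_subtypeVal.isClosedMap _ (hU i).1)
        (fun i => (hne i).image _)
        (fun i j hij => Set.disjoint_image_of_injective Subtype.val_injective (hdisj hij)) ?_
      rw [← Set.image_iUnion, hcover, Set.image_univ, Subtype.range_coe, hS]
  refine ⟨hfin, ?_⟩
  rw [Real.rpow_natCast, pow_mul]
  calc (Nat.card (ConnectedComponents S) : ℝ) ≤ ((4 * (s * d) + 5) ^ n : ℕ) := by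
        exact_mod_cast hcard
    _ = (4 * (s * d : ℝ) + 5) ^ n := by push_cast; rfl
    _ ≤ (B ^ 4) ^ n := by
      refine pow_le_pow_left₀ (by positivity) ?_ n
      nlinarith [pow_le_pow_left₀ (by norm_num) hB 3, mul_le_mul_of_nonneg_right
        (pow_le_pow_left₀ (by norm_num) hB 3) (by linarith : 0 ≤ B)]
end
end
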